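/- Sum capacity in the intermediate interference regime: For the deterministic two-hop interference channel with parameters (n, m, f, n̄, m̄) satisfying 2n ≤ 3m and m ≤ 2n, the sum capacity equals C_sum = min{max(2n − m, m), 2f}; in particular it does not depend on the overhearing parameters n̄, m̄. -/

import Mathlib

open scoped Classical

namespace TwoHopIC

/-- The `q × q` lower-shift matrix `S^k` over `F₂`, with `(S^k)_{i,j} = 1` iff `i = j + k`. -/
def shiftMat (q k : ℕ) : Matrix (Fin q) (Fin q) (ZMod 2) :=
  Matrix.of fun i j => if (i : ℕ) = (j : ℕ) + k then 1 else 0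

/-- Forward (first-hop) signal alphabet: vectors in `F₂^q` with `q = max m n`. -/
abbrev FSig (n m : ℕ) := Fin (max m n) → ZMod 2

/-- Backward/second-hop signal alphabet: vectors in `F₂^q̄` with `q̄ = max(m̄, n̄, f)`. -/
abbrev BSig (f nb mb : ℕ) := Fin (max mb (max nb f)) → ZMod 2

/-- A blocklength-`N` code with message sets of sizes `M1`, `M2`:
causal encoders at the sources (using the messages and the overheard signals),
causal encoders at the relays (using their received signals), and decoders at the
destinations (using the `N` received signals). -/
structure Code (n m f nb mb N M1 M2 : ℕ) where
  encS1 : (t : ℕ) → Fin M1 → (Fin t → BSig f nb mb) → FSig n m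
  encS2 : (t : ℕ) → Fin M2 → (Fin t → BSig f nb mb) → FSig n m
  encR1 : (t : ℕ) → (Fin t → FSig n m) → BSig f nb mb
  encR2 : (t : ℕ) → (Fin t → FSig n m) → BSig f nb mb
  dec1 : (Fin N → BSig f nb mb) → Fin M1
  dec2 : (Fin N → BSig f nb mb) → Fin M2

variable {n m f nb mb N M1 M2 : ℕ}

/-- Given a history `h` of source signals `(X_{S1}[·], X_{S2}[·])`, the signal received by
relay 1 at time `s`: `Y_{R1}[s] = S^{q-n} X_{S1}[s] ⊕ S^{q-m} X_{S2}[s]`. -/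
def relayRx1 (n m : ℕ) {t : ℕ} (h : Fin t → FSig n m × FSig n m) (s : Fin t) : FSig n m :=
  (shiftMat (max m n) (max m n - n)).mulVec (h s).1 +
  (shiftMat (max m n) (max m n - m)).mulVec (h s).2

/-- `Y_{R2}[s] = S^{q-m} X_{S1}[s] ⊕ S^{q-n} X_{S2}[s]`. -/
def relayRx2 (n m : ℕ) {t : ℕ} (h : Fin t → FSig n m × FSig n m) (s : Fin t) : FSig n m :=
  (shiftMat (max m n) (max m n - m)).mulVec (h s).1 +
  (shiftMat (max m n) (max m n - n)).mulVec (h s).2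

/-- Relay 1 transmitted signal `X_{R1}[s]`, a causal function of `Y_{R1}[1..s-1]`. -/
def relayTx1 (C : Code n m f nb mb N M1 M2) {t : ℕ}
    (h : Fin t → FSig n m × FSig n m) (s : Fin t) : BSig f nb mb :=
  C.encR1 s.val (fun u => relayRx1 n m h ⟨u.val, lt_trans u.isLt s.isLt⟩)

/-- Relay 2 transmitted signal `X_{R2}[s]`, a causal function of `Y_{R2}[1..s-1]`. -/
def relayTx2 (C : Code n m f nb mb N M1 M2) {t : ℕ}
    (h : Fin t → FSig n m × FSig n m) (s : Fin t) : BSig f nb mb :=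
  C.encR2 s.val (fun u => relayRx2 n m h ⟨u.val, lt_trans u.isLt s.isLt⟩)

/-- Source 1 overheard signal `Y_{S1}[s] = S^{q̄-n̄} X_{R1}[s] ⊕ S^{q̄-m̄} X_{R2}[s]`. -/
def srcRx1 (C : Code n m f nb mb N M1 M2) {t : ℕ}
    (h : Fin t → FSig n m × FSig n m) (s : Fin t) : BSig f nb mb :=
  (shiftMat (max mb (max nb f)) (max mb (max nb f) - nb)).mulVec (relayTx1 C h s) +
  (shiftMat (max mb (max nb f)) (max mb (max nb f) - mb)).mulVec (relayTx2 C h s)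

/-- Source 2 overheard signal `Y_{S2}[s] = S^{q̄-n̄} X_{R2}[s] ⊕ S^{q̄-m̄} X_{R1}[s]`. -/
def srcRx2 (C : Code n m f nb mb N M1 M2) {t : ℕ}
    (h : Fin t → FSig n m × FSig n m) (s : Fin t) : BSig f nb mb :=
  (shiftMat (max mb (max nb f)) (max mb (max nb f) - nb)).mulVec (relayTx2 C h s) +
  (shiftMat (max mb (max nb f)) (max mb (max nb f) - mb)).mulVec (relayTx1 C h s)

/-- The history `(X_{S1}[1..t], X_{S2}[1..t])` of source signals determined by the
messages `(w1, w2)`: at each time the sources apply their causal encoders to their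
message and the overheard signals so far. -/
def srcHist (C : Code n m f nb mb N M1 M2) (w1 : Fin M1) (w2 : Fin M2) :
    (t : ℕ) → Fin t → FSig n m × FSig n m
  | 0 => fun i => i.elim0
  | t + 1 =>
    Fin.snoc (srcHist C w1 w2 t)
      (C.encS1 t w1 (srcRx1 C (srcHist C w1 w2 t)),
       C.encS2 t w2 (srcRx2 C (srcHist C w1 w2 t)))

/-- `(X_{S1}[t], X_{S2}[t])`. -/
def srcXat (C : Code n m f nb mb N M1 M2) (w1 : Fin M1) (w2 : Fin M2) (t : ℕ) :
    FSig n m × FSig n m :=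
  srcHist C w1 w2 (t + 1) (Fin.last t)

/-- `Y_{R1}[t]`. -/
def relayRxAt1 (C : Code n m f nb mb N M1 M2) (w1 : Fin M1) (w2 : Fin M2) (t : ℕ) :
    FSig n m :=
  relayRx1 n m (srcHist C w1 w2 (t + 1)) (Fin.last t)

/-- `Y_{R2}[t]`. -/
def relayRxAt2 (C : Code n m f nb mb N M1 M2) (w1 : Fin M1) (w2 : Fin M2) (t : ℕ) :
    FSig n m :=
  relayRx2 n m (srcHist C w1 w2 (t + 1)) (Fin.last t)

/-- `X_{R1}[t]`. -/
def relayTxAt1 (C : Code n m f nb mb N M1 M2) (w1 : Fin M1) (w2 : Fin M2) (t : ℕ) :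
    BSig f nb mb :=
  relayTx1 C (srcHist C w1 w2 (t + 1)) (Fin.last t)

/-- `X_{R2}[t]`. -/
def relayTxAt2 (C : Code n m f nb mb N M1 M2) (w1 : Fin M1) (w2 : Fin M2) (t : ℕ) :
    BSig f nb mb :=
  relayTx2 C (srcHist C w1 w2 (t + 1)) (Fin.last t)

/-- `Y_{D1}[t] = S^{q̄-f} X_{R1}[t]`. -/
def destRx1 (C : Code n m f nb mb N M1 M2) (w1 : Fin M1) (w2 : Fin M2) (t : ℕ) :
    BSig f nb mb :=
  (shiftMat (max mb (max nb f)) (max mb (max nb f) - f)).mulVec (relayTxAt1 C w1 w2 t)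

/-- `Y_{D2}[t] = S^{q̄-f} X_{R2}[t]`. -/
def destRx2 (C : Code n m f nb mb N M1 M2) (w1 : Fin M1) (w2 : Fin M2) (t : ℕ) :
    BSig f nb mb :=
  (shiftMat (max mb (max nb f)) (max mb (max nb f) - f)).mulVec (relayTxAt2 C w1 w2 t)

/-- Probability of decoding error under independent uniform messages: since the channel is
deterministic, this is the fraction of message pairs `(w1, w2)` on which some decoder errs. -/
noncomputable def errProb (C : Code n m f nb mb N M1 M2) : ℝ :=
  ((Finset.univ.filter fun w : Fin M1 × Fin M2 =>
      C.dec1 (fun t => destRx1 C w.1 w.2 t.val) ≠ w.1 ∨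
      C.dec2 (fun t => destRx2 C w.1 w.2 t.val) ≠ w.2).card : ℝ) / ((M1 : ℝ) * (M2 : ℝ))

/-- A nonnegative rate pair `(R1, R2)` is achievable if for every `ε > 0` there is a
blocklength `N ≥ 1` and a code with message sets of sizes `⌈2^(N R1)⌉`, `⌈2^(N R2)⌉`
whose probability of error is at most `ε`. -/
def Achievable (n m f nb mb : ℕ) (R1 R2 : ℝ) : Prop :=
  0 ≤ R1 ∧ 0 ≤ R2 ∧
    ∀ ε : ℝ, 0 < ε →
      ∃ N : ℕ, 0 < N ∧
        ∃ C : Code n m f nb mb N ⌈(2 : ℝ) ^ ((N : ℝ) * R1)⌉₊ ⌈(2 : ℝ) ^ ((N : ℝ) * R2)⌉₊,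
          errProb C ≤ ε

/-- The sum capacity `C_sum = sup { R1 + R2 : (R1, R2) achievable }`. -/
noncomputable def sumCapacity (n m f nb mb : ℕ) : ℝ :=
  sSup {r : ℝ | ∃ R1 R2 : ℝ, Achievable n m f nb mb R1 R2 ∧ r = R1 + R2}

end TwoHopIC

namespace TwoHopIC

section Shift

theorem shiftMat_mulVec (q k : ℕ) (x : Fin q → ZMod 2) (i : Fin q) :
    (shiftMat q k).mulVec x i =
      if k ≤ (i : ℕ) then x ⟨(i : ℕ) - k, lt_of_le_of_lt (Nat.sub_le _ _) i.isLt⟩ else 0 := by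
  simp only [Matrix.mulVec, dotProduct, shiftMat, Matrix.of_apply, ite_mul, one_mul, zero_mul]
  split_ifs with h
  · rw [Finset.sum_eq_single ⟨(i : ℕ) - k, lt_of_le_of_lt (Nat.sub_le _ _) i.isLt⟩]
    · simp [Nat.sub_add_cancel h]
    · intro j _ hj
      rw [if_neg]
      intro hij
      exact hj (Fin.ext (by simp; omega))
    · simp
  · exact Finset.sum_eq_zero fun j _ => if_neg (by omega)

theorem shiftMat_mulVec_coe (q k : ℕ) (g : ℕ → ZMod 2) (i : Fin q) :
    (shiftMat q k).mulVec (fun j => g j) i = if k ≤ (i : ℕ) then g (i - k) else 0 := by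
  rw [shiftMat_mulVec]

/-- The output of `S^{q-k}` depends only on, and determines, the `k` top levels of the input. -/
theorem shiftMat_mulVec_eq_iff {q k : ℕ} (hk : k ≤ q) (x y : Fin q → ZMod 2) :
    (shiftMat q (q - k)).mulVec x = (shiftMat q (q - k)).mulVec y ↔
      ∀ i : Fin q, (i : ℕ) < k → x i = y i := by
  constructor
  · intro h i hi
    have := congrFun h ⟨i + (q - k), by omega⟩
    simpa [shiftMat_mulVec] using this
  · intro h
    funext i
    simp only [shiftMat_mulVec]
    split_ifs with hki
    · exact h _ (by simp; omega)
    · rfl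

end Shift

section Trajectory

variable {n m f nb mb N M1 M2 : ℕ}

theorem srcHist_apply (C : Code n m f nb mb N M1 M2) (w1 : Fin M1) (w2 : Fin M2) (t : ℕ)
    (s : Fin t) : srcHist C w1 w2 t s = srcXat C w1 w2 s := by
  induction t with
  | zero => exact s.elim0
  | succ t ih =>
    refine Fin.lastCases ?_ (fun i => ?_) s
    · rfl
    · rw [srcHist, Fin.snoc_castSucc, ih i]
      rfl

theorem srcXat_eq (C : Code n m f nb mb N M1 M2) (w1 : Fin M1) (w2 : Fin M2) (t : ℕ) :
    srcXat C w1 w2 t = (C.encS1 t w1 (srcRx1 C (srcHist C w1 w2 t)),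
      C.encS2 t w2 (srcRx2 C (srcHist C w1 w2 t))) := by
  rw [srcXat, srcHist, Fin.snoc_last]

theorem relayRxAt1_eq (C : Code n m f nb mb N M1 M2) (w1 : Fin M1) (w2 : Fin M2) (t : ℕ) :
    relayRxAt1 C w1 w2 t =
      (shiftMat (max m n) (max m n - n)).mulVec (srcXat C w1 w2 t).1 +
      (shiftMat (max m n) (max m n - m)).mulVec (srcXat C w1 w2 t).2 := rfl

theorem relayRxAt2_eq (C : Code n m f nb mb N M1 M2) (w1 : Fin M1) (w2 : Fin M2) (t : ℕ) :
    relayRxAt2 C w1 w2 t =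
      (shiftMat (max m n) (max m n - m)).mulVec (srcXat C w1 w2 t).1 +
      (shiftMat (max m n) (max m n - n)).mulVec (srcXat C w1 w2 t).2 := rfl

theorem relayTxAt1_eq (C : Code n m f nb mb N M1 M2) (w1 : Fin M1) (w2 : Fin M2) (t : ℕ) :
    relayTxAt1 C w1 w2 t = C.encR1 t (fun s => relayRxAt1 C w1 w2 s) := by
  simp only [relayTxAt1, relayTx1, relayRx1, srcHist_apply, relayRxAt1_eq]
  rfl

theorem relayTxAt2_eq (C : Code n m f nb mb N M1 M2) (w1 : Fin M1) (w2 : Fin M2) (t : ℕ) :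
    relayTxAt2 C w1 w2 t = C.encR2 t (fun s => relayRxAt2 C w1 w2 s) := by
  simp only [relayTxAt2, relayTx2, relayRx2, srcHist_apply, relayRxAt2_eq]
  rfl

end Trajectory

section Converse

variable {n m f nb mb N M1 M2 : ℕ}

/-- The message pairs that both destinations decode correctly. -/
noncomputable def decodedPairs (C : Code n m f nb mb N M1 M2) : Finset (Fin M1 × Fin M2) :=
  Finset.univ.filter fun w =>
    C.dec1 (fun t => destRx1 C w.1 w.2 t.val) = w.1 ∧
    C.dec2 (fun t => destRx2 C w.1 w.2 t.val) = w.2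

theorem card_decodedPairs (C : Code n m f nb mb N M1 M2) (hM1 : 0 < M1) (hM2 : 0 < M2) :
    ((decodedPairs C).card : ℝ) = (1 - errProb C) * (M1 * M2) := by
  have hsum := Finset.card_filter_add_card_filter_not (s := (Finset.univ : Finset (Fin M1 × Fin M2)))
    (fun w => C.dec1 (fun t => destRx1 C w.1 w.2 t.val) = w.1 ∧
      C.dec2 (fun t => destRx2 C w.1 w.2 t.val) = w.2)
  simp only [not_and_or, Finset.card_univ, Fintype.card_prod, Fintype.card_fin] at hsum
  have hsum' : ((decodedPairs C).card : ℝ) + ((Finset.univ.filter fun w : Fin M1 × Fin M2 =>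
      C.dec1 (fun t => destRx1 C w.1 w.2 t.val) ≠ w.1 ∨
      C.dec2 (fun t => destRx2 C w.1 w.2 t.val) ≠ w.2).card : ℝ) = M1 * M2 := by
    exact_mod_cast hsum
  have h1 : (0 : ℝ) < M1 := by exact_mod_cast hM1
  have h2 : (0 : ℝ) < M2 := by exact_mod_cast hM2
  rw [errProb, sub_mul, div_mul_cancel₀ _ (by positivity)]
  linarith

/-- Destination signals are determined by the first `f` levels of the relay signals. -/
theorem card_decodedPairs_le_secondHop (C : Code n m f nb mb N M1 M2) :
    (decodedPairs C).card ≤ 2 ^ (N * (2 * f)) := by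
  have hf : f ≤ max mb (max nb f) := by simp
  let Φ : Fin M1 × Fin M2 → (Fin N → Fin f → ZMod 2) × (Fin N → Fin f → ZMod 2) := fun w =>
    (fun t i => relayTxAt1 C w.1 w.2 t (Fin.castLE hf i),
      fun t i => relayTxAt2 C w.1 w.2 t (Fin.castLE hf i))
  have hinj : Set.InjOn Φ (decodedPairs C) := by
    intro w hw w' hw' h
    simp only [decodedPairs, Finset.coe_filter, Finset.mem_univ, true_and,
      Set.mem_ofPred_eq] at hw hw'
    obtain ⟨h1, h2⟩ := Prod.mk.inj h
    refine Prod.ext ?_ ?_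
    · rw [← hw.1, ← hw'.1]
      congr 1
      funext t
      refine (shiftMat_mulVec_eq_iff hf _ _).2 fun i hi => ?_
      exact congrFun (congrFun h1 t) ⟨i, hi⟩
    · rw [← hw.2, ← hw'.2]
      congr 1
      funext t
      refine (shiftMat_mulVec_eq_iff hf _ _).2 fun i hi => ?_
      exact congrFun (congrFun h2 t) ⟨i, hi⟩
  have hcard := Finset.card_le_card_of_injOn Φ (fun _ _ => Finset.mem_univ _) hinj
  refine hcard.trans (le_of_eq ?_)
  simp only [Finset.card_univ, Fintype.card_prod, Fintype.card_fun, ZMod.card, Fintype.card_fin]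
  rw [← pow_mul, ← pow_add]
  congr 1
  ring

/-- The first message, the observations of relay 1 and the levels of source 2 that relay 1 does
not see determine the whole trajectory, whatever the sources overhear. -/
theorem srcHist_eq_of_relayRxAt1_eq (C : Code n m f nb mb N M1 M2) (w1 : Fin M1)
    (w2 w2' : Fin M2) (T : ℕ)
    (hY : ∀ t < T, relayRxAt1 C w1 w2 t = relayRxAt1 C w1 w2' t)
    (hX : ∀ t < T, ∀ i : Fin (max m n), m ≤ (i : ℕ) →
      (srcXat C w1 w2 t).2 i = (srcXat C w1 w2' t).2 i) :
    srcHist C w1 w2 T = srcHist C w1 w2' T := by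
  induction T with
  | zero => exact funext fun i => i.elim0
  | succ T ih =>
    have hh := ih (fun t ht => hY t (by omega)) (fun t ht => hX t (by omega))
    have hX1 : (srcXat C w1 w2 T).1 = (srcXat C w1 w2' T).1 := by
      rw [srcXat_eq, srcXat_eq, hh]
    have hX2 : (srcXat C w1 w2 T).2 = (srcXat C w1 w2' T).2 := by
      have hy := hY T (by omega)
      rw [relayRxAt1_eq, relayRxAt1_eq, hX1, add_right_inj,
        shiftMat_mulVec_eq_iff (le_max_left m n)] at hy
      funext i
      by_cases hi : (i : ℕ) < m
      · exact hy i hi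
      · exact hX T (by omega) i (by omega)
    funext s
    refine Fin.lastCases ?_ (fun i => ?_) s
    · exact Prod.ext hX1 hX2
    · have := congrFun hh i
      rw [srcHist_apply, srcHist_apply] at this
      rw [srcHist_apply, srcHist_apply]
      exact this

theorem card_decodedPairs_le_firstHop (C : Code n m f nb mb N M1 M2) :
    (decodedPairs C).card ≤ 2 ^ (N * (max m n + (n - m))) := by
  let Φ : Fin M1 × Fin M2 → (Fin N → FSig n m) × (Fin N → Fin (n - m) → ZMod 2) := fun w =>
    (fun t => relayRxAt1 C w.1 w.2 t,
      fun t i => (srcXat C w.1 w.2 t).2 ⟨m + i, by have := i.isLt; omega⟩)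
  have hinj : Set.InjOn Φ (decodedPairs C) := by
    rintro ⟨w1, w2⟩ hw ⟨w1', w2'⟩ hw' h
    simp only [decodedPairs, Finset.coe_filter, Finset.mem_univ, true_and,
      Set.mem_ofPred_eq] at hw hw'
    obtain ⟨h1, h2⟩ := Prod.mk.inj h
    dsimp only at h1 h2
    have hY : ∀ t < N, relayRxAt1 C w1 w2 t = relayRxAt1 C w1' w2' t := fun t ht =>
      congrFun h1 ⟨t, ht⟩
    obtain rfl : w1 = w1' := by
      rw [← hw.1, ← hw'.1]
      congr 1
      funext t
      rw [destRx1, destRx1, relayTxAt1_eq, relayTxAt1_eq]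
      congr 2
      funext s
      exact hY s (s.isLt.trans t.isLt)
    have hh := srcHist_eq_of_relayRxAt1_eq C w1 w2 w2' N hY (fun t ht i hi => by
      have := congrFun (congrFun h2 ⟨t, ht⟩) ⟨i - m, by have := i.isLt; omega⟩
      simpa [Nat.add_sub_cancel' hi] using this)
    have hX : ∀ t < N, srcXat C w1 w2 t = srcXat C w1 w2' t := fun t ht => by
      have := congrFun hh ⟨t, ht⟩
      rwa [srcHist_apply, srcHist_apply] at this
    refine Prod.ext rfl ?_
    dsimp only
    rw [← hw.2, ← hw'.2]
    congr 1
    funext t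
    rw [destRx2, destRx2, relayTxAt2_eq, relayTxAt2_eq]
    congr 2
    funext s
    rw [relayRxAt2_eq, relayRxAt2_eq, hX s (s.isLt.trans t.isLt)]
  have hcard := Finset.card_le_card_of_injOn Φ (fun _ _ => Finset.mem_univ _) hinj
  refine hcard.trans (le_of_eq ?_)
  simp only [Finset.card_univ, Fintype.card_prod, Fintype.card_fun, ZMod.card, Fintype.card_fin]
  rw [← pow_mul, ← pow_mul, ← pow_add]
  congr 1
  ring

/-- A uniform bound `2^{Nb}` on the number of correctly decoded message pairs bounds the
achievable sum rates by `b`. -/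
theorem Achievable.add_le {R1 R2 : ℝ} (h : Achievable n m f nb mb R1 R2) (b : ℕ)
    (hb : ∀ (N M1 M2 : ℕ) (C : Code n m f nb mb N M1 M2),
      (decodedPairs C).card ≤ 2 ^ (N * b)) : R1 + R2 ≤ b := by
  obtain ⟨-, -, h⟩ := h
  by_contra! hlt
  set δ : ℝ := R1 + R2 - b with hδ
  have hδ0 : 0 < δ := by linarith
  have h2 : (2 : ℝ) ^ (-δ) < 1 := Real.rpow_lt_one_of_one_lt_of_neg (by norm_num) (by linarith)
  obtain ⟨N, hN, C, hC⟩ := h ((1 - (2 : ℝ) ^ (-δ)) / 2) (by linarith)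
  have hN1 : (1 : ℝ) ≤ N := by exact_mod_cast hN
  have hpos1 : (0 : ℝ) < 2 ^ ((N : ℝ) * R1) := by positivity
  have hpos2 : (0 : ℝ) < 2 ^ ((N : ℝ) * R2) := by positivity
  have hcard := card_decodedPairs C (Nat.ceil_pos.2 hpos1) (Nat.ceil_pos.2 hpos2)
  have hle : ((decodedPairs C).card : ℝ) ≤ 2 ^ ((N : ℝ) * b) := by
    rw [← Nat.cast_mul, Real.rpow_natCast]
    exact_mod_cast hb _ _ _ C
  have hM : (2 : ℝ) ^ ((N : ℝ) * (R1 + R2)) ≤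
      (⌈(2 : ℝ) ^ ((N : ℝ) * R1)⌉₊ : ℝ) * ⌈(2 : ℝ) ^ ((N : ℝ) * R2)⌉₊ := by
    rw [mul_add, Real.rpow_add (by norm_num)]
    gcongr <;> exact Nat.le_ceil _
  have hsplit : (2 : ℝ) ^ ((N : ℝ) * b) =
      2 ^ (-(N * δ)) * (2 : ℝ) ^ ((N : ℝ) * (R1 + R2)) := by
    rw [← Real.rpow_add (by norm_num)]
    congr 1
    rw [hδ]
    ring
  have hmono : (2 : ℝ) ^ (-(N * δ)) ≤ 2 ^ (-δ) :=
    Real.rpow_le_rpow_of_exponent_le (by norm_num) (by nlinarith)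
  have hP : (0 : ℝ) < 2 ^ ((N : ℝ) * (R1 + R2)) := by positivity
  have hlow : (1 - errProb C) * 2 ^ ((N : ℝ) * (R1 + R2)) ≤ 2 ^ (-δ) * 2 ^ ((N : ℝ) * (R1 + R2)) :=
    calc _ ≤ (1 - errProb C) * ((⌈(2 : ℝ) ^ ((N : ℝ) * R1)⌉₊ : ℝ) * ⌈(2 : ℝ) ^ ((N : ℝ) * R2)⌉₊) :=
          mul_le_mul_of_nonneg_left hM (by linarith [Real.rpow_pos_of_pos two_pos (-δ)])
      _ ≤ 2 ^ (-(N * δ)) * (2 : ℝ) ^ ((N : ℝ) * (R1 + R2)) := by rw [← hcard, ← hsplit]; exact hle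
      _ ≤ _ := mul_le_mul_of_nonneg_right hmono hP.le
  have := le_of_mul_le_mul_right hlow hP
  linarith

end Converse

section LevelCode

/-- An allocation of the `m` top levels for cross shift `d`: both users send fresh bits on the
levels in `K`; user `i` additionally sends fresh bits on the levels in `Ti`, each of them repeated
`d` levels higher. -/
structure LevelSplit (d m : ℕ) (K T1 T2 : Finset ℕ) : Prop where
  add_lt_of_mem : ∀ l ∈ K, l + d < m
  le_of_mem_left : ∀ l ∈ T1, d ≤ l ∧ l < m ∧ (0 < d → m ≤ l + d)
  le_of_mem_right : ∀ l ∈ T2, d ≤ l ∧ l < m ∧ (0 < d → m ≤ l + d)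
  disjoint : Disjoint T1 T2
  disjoint_left : Disjoint K T1
  disjoint_right : Disjoint K T2
  sub_notMem_right : ∀ l ∈ K ∪ T1, d ≤ l → l - d ∉ K ∪ T2
  sub_notMem_left : ∀ l ∈ K ∪ T2, d ≤ l → l - d ∉ K ∪ T1

theorem LevelSplit.symm {d m : ℕ} {K T1 T2 : Finset ℕ} (h : LevelSplit d m K T1 T2) :
    LevelSplit d m K T2 T1 :=
  ⟨h.add_lt_of_mem, h.le_of_mem_right, h.le_of_mem_left, h.disjoint.symm, h.disjoint_right,
    h.disjoint_left, h.sub_notMem_left, h.sub_notMem_right⟩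

theorem exists_levelSplit {d m : ℕ} (hdm : 2 * d ≤ m) :
    ∃ K T1 T2 : Finset ℕ, LevelSplit d m K T1 T2 ∧
      (K ∪ T1).card = (m + 1) / 2 ∧ (K ∪ T2).card = m / 2 := by
  rcases Nat.eq_zero_or_pos d with rfl | hd
  · refine ⟨∅, Finset.range ((m + 1) / 2), Finset.Ico ((m + 1) / 2) m, ?_, by simp, ?_⟩
    · constructor
      · simp
      · simp; omega
      · simp
      · rw [Finset.disjoint_left]; simp; omega
      · simp
      · simp
      · simp; omega
      · simp; omega
    · simp; omega
  · set K := (Finset.range m).filter fun i => i + d < m ∧ Even (i / d) with hK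
    set L := (Finset.range m).filter fun i => m ≤ i + d ∧ Even (i / d) with hL
    have hdiv : ∀ i, d ≤ i → (Even ((i - d) / d) ↔ ¬ Even (i / d)) := by
      intro i hi
      obtain ⟨j, rfl⟩ := Nat.exists_eq_add_of_le hi
      rw [Nat.add_sub_cancel_left, Nat.add_div_left _ hd, Nat.even_add_one, not_not]
    have hcard : m = 2 * K.card + L.card := by
      have hodd : ((Finset.range m).filter fun i => ¬ Even (i / d)) =
          K.image (fun i => i + d) := by
        ext i
        simp only [hK, Finset.mem_filter, Finset.mem_range, Finset.mem_image]
        constructor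
        · rintro ⟨hi, ho⟩
          have hdi : d ≤ i := by
            by_contra! hlt
            exact ho (by simp [Nat.div_eq_of_lt hlt])
          exact ⟨i - d, ⟨by omega, by omega, (hdiv i hdi).2 ho⟩, by omega⟩
        · rintro ⟨j, ⟨_, hj, he⟩, rfl⟩
          exact ⟨hj, (hdiv _ (by omega)).1 (by simpa using he)⟩
      have heven : ((Finset.range m).filter fun i => Even (i / d)) = K ∪ L := by
        ext i
        simp only [hK, hL, Finset.mem_filter, Finset.mem_range, Finset.mem_union]
        grind
      have hdisj : Disjoint K L := by
        rw [Finset.disjoint_left]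
        simp only [hK, hL, Finset.mem_filter]
        omega
      have hsum := Finset.card_filter_add_card_filter_not (s := Finset.range m)
        (fun i => Even (i / d))
      rw [hodd, heven, Finset.card_union_of_disjoint hdisj,
        Finset.card_image_of_injective _ (add_left_injective d), Finset.card_range] at hsum
      omega
    obtain ⟨T, hTL, hTcard⟩ := Finset.exists_subset_card_eq
      (show (L.card + 1) / 2 ≤ L.card by omega)
    have hmemL : ∀ l ∈ L, d ≤ l ∧ l < m ∧ (0 < d → m ≤ l + d) := by
      intro l hl
      simp only [hL, Finset.mem_filter, Finset.mem_range] at hl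
      omega
    have hevK : ∀ l ∈ K, l + d < m ∧ Even (l / d) := by
      intro l hl
      simp only [hK, Finset.mem_filter] at hl
      exact hl.2
    have hevL : ∀ l ∈ L, m ≤ l + d ∧ Even (l / d) := by
      intro l hl
      simp only [hL, Finset.mem_filter] at hl
      exact hl.2
    have hS : (L \ T) ⊆ L := Finset.sdiff_subset
    have hKL : ∀ T' ⊆ L, Disjoint K T' := by
      intro T' hT'
      rw [Finset.disjoint_left]
      intro l hl hl'
      have := hevK l hl
      have := hevL l (hT' hl')
      omega
    have hev : ∀ T' ⊆ L, ∀ l ∈ K ∪ T', Even (l / d) := by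
      intro T' hT' l hl
      rcases Finset.mem_union.1 hl with h | h
      · exact (hevK l h).2
      · exact (hevL l (hT' h)).2
    refine ⟨K, T, L \ T, ⟨fun l hl => (hevK l hl).1, fun l hl => hmemL l (hTL hl),
      fun l hl => hmemL l (hS hl), Finset.disjoint_sdiff, hKL _ hTL, hKL _ hS, ?_, ?_⟩, ?_, ?_⟩
    · exact fun l hl hdl hmem => (hdiv l hdl).1 (hev _ hS _ hmem) (hev _ hTL l hl)
    · exact fun l hl hdl hmem => (hdiv l hdl).1 (hev _ hTL _ hmem) (hev _ hS l hl)
    · rw [Finset.card_union_of_disjoint (hKL _ hTL)]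
      omega
    · rw [Finset.card_union_of_disjoint (hKL _ hS), Finset.card_sdiff_of_subset hTL]
      omega

/-- Level `l` of the signal carrying the bits `u`: fresh bits on `K`, `T` and the private levels
`m ≤ l < n`, and repetitions of the bits of `T`. -/
noncomputable def levelSignal (d m n : ℕ) (K T : Finset ℕ) (u : ℕ → ZMod 2) (l : ℕ) : ZMod 2 :=
  if l ∈ (K ∪ T) ∪ Finset.Ico m n then u l else if l + d ∈ T then u (l + d) else 0

variable {d m n : ℕ} {K T1 T2 : Finset ℕ}

theorem LevelSplit.lt_of_mem (h : LevelSplit d m K T1 T2) {l : ℕ} (hl : l ∈ K ∪ T1) : l < m := by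
  rcases Finset.mem_union.1 hl with hl | hl
  · have := h.add_lt_of_mem l hl
    omega
  · exact (h.le_of_mem_left l hl).2.1

/-- On the levels where user 1 sends fresh common bits, the shifted signal of user 2 vanishes. -/
theorem LevelSplit.levelSignal_sub_eq_zero (h : LevelSplit d m K T1 T2) (v : ℕ → ZMod 2) {l : ℕ}
    (hl : l ∈ K ∪ T1) (hdl : d ≤ l) : levelSignal d m n K T2 v (l - d) = 0 := by
  have hlm := h.lt_of_mem hl
  have h1 := h.sub_notMem_right l hl hdl
  have h2 : l ∉ T2 := by
    rcases Finset.mem_union.1 hl with hl | hl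
    · exact Finset.disjoint_left.1 h.disjoint_right hl
    · exact Finset.disjoint_left.1 h.disjoint hl
  rw [levelSignal, if_neg, if_neg]
  · rwa [Nat.sub_add_cancel hdl]
  · rw [Finset.mem_union, Finset.mem_Ico]
    rintro (h' | h')
    · exact h1 h'
    · omega

theorem LevelSplit.eq_of_common (h : LevelSplit d m K T1 T2) {u u' v v' : ℕ → ZMod 2} {l : ℕ}
    (hl : l ∈ K ∪ T1)
    (heq : (levelSignal d m n K T1 u l + if d ≤ l then levelSignal d m n K T2 v (l - d) else 0) =
      levelSignal d m n K T1 u' l + if d ≤ l then levelSignal d m n K T2 v' (l - d) else 0) :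
    u l = u' l := by
  have hu : ∀ u, levelSignal d m n K T1 u l = u l := fun u => if_pos (Finset.mem_union_left _ hl)
  rw [hu, hu] at heq
  by_cases hdl : d ≤ l
  · rwa [if_pos hdl, if_pos hdl, h.levelSignal_sub_eq_zero v hl hdl,
      h.levelSignal_sub_eq_zero v' hl hdl, add_zero, add_zero] at heq
  · rwa [if_neg hdl, if_neg hdl, add_zero, add_zero] at heq

/-- Decodability when the own signal is the stronger one. -/
theorem LevelSplit.eq_of_weak (h : LevelSplit d m K T1 T2) (hn : n = m + d) (hdm : d ≤ m)
    {u u' v v' : ℕ → ZMod 2}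
    (heq : ∀ l < n,
      (levelSignal d m n K T1 u l + if d ≤ l then levelSignal d m n K T2 v (l - d) else 0) =
      levelSignal d m n K T1 u' l + if d ≤ l then levelSignal d m n K T2 v' (l - d) else 0)
    {l : ℕ} (hl : l ∈ (K ∪ T1) ∪ Finset.Ico m n) : u l = u' l := by
  rcases Finset.mem_union.1 hl with hl' | hl'
  · exact h.eq_of_common hl' (heq l (by have := h.lt_of_mem hl'; omega))
  rw [Finset.mem_Ico] at hl'
  have hd : 0 < d := by omega
  have hlast : levelSignal d m n K T2 v (l - d) = levelSignal d m n K T2 v' (l - d) := by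
    by_cases hT2 : l - d ∈ T2
    · obtain ⟨hdl, hlm, hge⟩ := h.le_of_mem_right _ hT2
      have hown : ∀ u, levelSignal d m n K T1 u (l - d) = 0 := by
        intro u
        have hK : l - d ∉ K := fun hk => Finset.disjoint_left.1 h.disjoint_right hk hT2
        have hT1 : l - d ∉ T1 := fun hk => Finset.disjoint_left.1 h.disjoint hk hT2
        have hT1' : l - d + d ∉ T1 := fun hk => by
          have := (h.le_of_mem_left _ hk).2.1
          omega
        rw [levelSignal, if_neg, if_neg hT1']
        simp only [Finset.mem_union, Finset.mem_Ico, hK, hT1, false_or]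
        omega
      have hrep : ∀ v, levelSignal d m n K T2 v (l - d - d) = v (l - d) := by
        intro v
        have hnot := h.sub_notMem_left _ (Finset.mem_union_right _ hT2) hdl
        have hnotT2 : l - d - d ∉ T2 := fun hk => by
          have := (h.le_of_mem_right _ hk).2.2 hd
          omega
        rw [levelSignal, if_neg, if_pos]
        · rw [Nat.sub_add_cancel hdl]
        · rwa [Nat.sub_add_cancel hdl]
        · simp only [Finset.mem_union, Finset.mem_Ico, not_or] at hnot ⊢
          exact ⟨⟨hnot.1, hnotT2⟩, by omega⟩
      have hmid := heq (l - d) (by omega)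
      rw [if_pos hdl, if_pos hdl, hown, hown, hrep, hrep, zero_add, zero_add] at hmid
      have hin : l - d ∈ (K ∪ T2) ∪ Finset.Ico m n := by simp [hT2]
      rw [levelSignal, levelSignal, if_pos hin, if_pos hin, hmid]
    · have hz : ∀ v, levelSignal d m n K T2 v (l - d) = 0 := by
        intro v
        have hK : l - d ∉ K := fun hk => by
          have := h.add_lt_of_mem _ hk
          omega
        have hT2' : l - d + d ∉ T2 := fun hk => by
          have := (h.le_of_mem_right _ hk).2.1
          omega
        rw [levelSignal, if_neg, if_neg hT2']
        simp only [Finset.mem_union, Finset.mem_Ico, hK, hT2, false_or]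
        omega
      rw [hz, hz]
  have hfin := heq l hl'.2
  rw [if_pos (by omega), if_pos (by omega), hlast, add_left_inj, levelSignal, levelSignal,
    if_pos hl, if_pos hl] at hfin
  exact hfin

/-- Decodability when the interfering signal is the stronger one. -/
theorem LevelSplit.eq_of_strong (h : LevelSplit d m K T1 T2) (hn : m = n + d) (hd : 0 < d)
    {u u' v v' : ℕ → ZMod 2}
    (heq : ∀ l < m,
      (levelSignal d m n K T2 v l + if d ≤ l then levelSignal d m n K T1 u (l - d) else 0) =
      levelSignal d m n K T2 v' l + if d ≤ l then levelSignal d m n K T1 u' (l - d) else 0)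
    {l : ℕ} (hl : l ∈ (K ∪ T1) ∪ Finset.Ico m n) : u l = u' l := by
  have hv : ∀ l ∈ K ∪ T2, v l = v' l := fun l hl =>
    h.symm.eq_of_common hl (heq l (h.symm.lt_of_mem hl))
  have hlevel : ∀ l, levelSignal d m n K T2 v l = levelSignal d m n K T2 v' l := by
    intro l
    have hIco : Finset.Ico m n = ∅ := Finset.Ico_eq_empty (by omega)
    rw [levelSignal, levelSignal, hIco, Finset.union_empty]
    split_ifs with h1 h2
    · exact hv l h1
    · exact hv _ (Finset.mem_union_right _ h2)
    · rfl
  have hu : ∀ l, l + d < m → levelSignal d m n K T1 u l = levelSignal d m n K T1 u' l := by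
    intro l hl
    have := heq (l + d) hl
    rwa [hlevel, if_pos (by omega), if_pos (by omega), add_right_inj, Nat.add_sub_cancel] at this
  rw [Finset.mem_union, Finset.mem_Ico, Finset.mem_union] at hl
  rcases hl with (hl | hl) | hl
  · have := hu l (h.add_lt_of_mem l hl)
    have hin : l ∈ (K ∪ T1) ∪ Finset.Ico m n := by simp [hl]
    rwa [levelSignal, levelSignal, if_pos hin, if_pos hin] at this
  · obtain ⟨hdl, hlm, hge⟩ := h.le_of_mem_left l hl
    have := hu (l - d) (by omega)
    by_cases hin : l - d ∈ (K ∪ T1) ∪ Finset.Ico m n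
    · have hnot := h.sub_notMem_right l (Finset.mem_union_right _ hl) hdl
      have hnotT1 : l - d ∉ T1 := fun hk => by
        have := (h.le_of_mem_left _ hk).2.2 hd
        omega
      simp only [Finset.mem_union, Finset.mem_Ico, not_or] at hnot hin
      rcases hin with (hin | hin) | hin
      · exact absurd hin hnot.1
      · exact absurd hin hnotT1
      · omega
    · have hT : l - d + d ∈ T1 := by rwa [Nat.sub_add_cancel hdl]
      rwa [levelSignal, levelSignal, if_neg hin, if_neg hin, if_pos hT, if_pos hT,
        Nat.sub_add_cancel hdl] at this
  · omega

/-- The bits of user 1 can be decoded from the observation of relay 1. -/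
theorem LevelSplit.eq_of_relayRx (h : LevelSplit d m K T1 T2) (hd : d = (n - m) + (m - n))
    (hdm : 2 * d ≤ m) {u u' v v' : ℕ → ZMod 2}
    (heq : (shiftMat (max m n) (max m n - n)).mulVec (fun i => levelSignal d m n K T1 u i) +
        (shiftMat (max m n) (max m n - m)).mulVec (fun i => levelSignal d m n K T2 v i) =
      (shiftMat (max m n) (max m n - n)).mulVec (fun i => levelSignal d m n K T1 u' i) +
        (shiftMat (max m n) (max m n - m)).mulVec (fun i => levelSignal d m n K T2 v' i))
    {l : ℕ} (hl : l ∈ (K ∪ T1) ∪ Finset.Ico m n) : u l = u' l := by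
  have hlevel : ∀ l (hl : l < max m n), _ := fun l hl => congrFun heq ⟨l, hl⟩
  simp only [Pi.add_apply, shiftMat_mulVec_coe] at hlevel
  rcases le_or_gt m n with hmn | hmn
  · have e1 : max m n - n = 0 := by omega
    have e2 : max m n - m = d := by omega
    simp only [e1, e2, Nat.zero_le, if_true, Nat.sub_zero] at hlevel
    exact h.eq_of_weak (by omega) (by omega) (fun l hl => hlevel l (by omega)) hl
  · have e1 : max m n - n = d := by omega
    have e2 : max m n - m = 0 := by omega
    simp only [e1, e2, Nat.zero_le, if_true, Nat.sub_zero] at hlevel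
    refine h.eq_of_strong (by omega) (by omega) (v := v) (v' := v') (fun l hl => ?_) hl
    rw [add_comm, hlevel l (by omega), add_comm]

theorem exists_decoder {α β γ : Type*} [Nonempty α] (F : α → β → γ)
    (hF : ∀ u u' v v', F u v = F u' v' → u = u') : ∃ dec : γ → α, ∀ u v, dec (F u v) = u := by
  refine ⟨fun y => if h : ∃ u v, F u v = y then h.choose else Classical.arbitrary α,
    fun u v => ?_⟩
  have h : ∃ u' v', F u' v' = F u v := ⟨u, v, rfl⟩
  beta_reduce
  rw [dif_pos h]
  obtain ⟨v', hv'⟩ := h.choose_spec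
  exact hF _ _ _ _ hv'

/-- Any bit vector can be placed injectively on a large enough set of levels. -/
theorem exists_placement (A : Finset ℕ) {k : ℕ} (hk : k ≤ A.card) :
    ∃ p : (Fin k → ZMod 2) → ℕ → ZMod 2, ∀ u u', (∀ l ∈ A, p u l = p u' l) → u = u' := by
  let g : Fin k → ℕ := fun i => A.orderEmbOfFin rfl (Fin.castLE hk i)
  have hg : Function.Injective g := fun i j hij =>
    Fin.castLE_injective hk ((A.orderEmbOfFin rfl).injective hij)
  refine ⟨fun u => Function.extend g u 0, fun u u' h => funext fun i => ?_⟩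
  have := h (g i) (Finset.orderEmbOfFin_mem A rfl _)
  beta_reduce at this
  rwa [hg.extend_apply, hg.extend_apply] at this

/-- A single use of the first hop conveys `k1 + k2` bits to the relays. -/
theorem exists_firstHop_code {n m k1 k2 : ℕ} (h1 : 2 * n ≤ 3 * m) (h2 : m ≤ 2 * n)
    (hk1 : k1 ≤ (max m n + (n - m) + 1) / 2) (hk2 : k2 ≤ (max m n + (n - m)) / 2) :
    ∃ (e1 : (Fin k1 → ZMod 2) → FSig n m) (e2 : (Fin k2 → ZMod 2) → FSig n m)
      (d1 : FSig n m → Fin k1 → ZMod 2) (d2 : FSig n m → Fin k2 → ZMod 2),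
      (∀ u v, d1 ((shiftMat (max m n) (max m n - n)).mulVec (e1 u) +
        (shiftMat (max m n) (max m n - m)).mulVec (e2 v)) = u) ∧
      (∀ u v, d2 ((shiftMat (max m n) (max m n - m)).mulVec (e1 u) +
        (shiftMat (max m n) (max m n - n)).mulVec (e2 v)) = v) := by
  obtain ⟨d, hd⟩ : ∃ d, d = (n - m) + (m - n) := ⟨_, rfl⟩
  have hdm : 2 * d ≤ m := by omega
  obtain ⟨K, T1, T2, hsplit, hc1, hc2⟩ := exists_levelSplit hdm
  have hdisj : ∀ A : Finset ℕ, (∀ l ∈ A, l < m) → Disjoint A (Finset.Ico m n) := by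
    intro A hA
    rw [Finset.disjoint_left]
    intro l hl hl'
    have := hA l hl
    rw [Finset.mem_Ico] at hl'
    omega
  have hcard1 : k1 ≤ ((K ∪ T1) ∪ Finset.Ico m n).card := by
    rw [Finset.card_union_of_disjoint (hdisj _ fun l => hsplit.lt_of_mem), hc1, Nat.card_Ico]
    omega
  have hcard2 : k2 ≤ ((K ∪ T2) ∪ Finset.Ico m n).card := by
    rw [Finset.card_union_of_disjoint (hdisj _ fun l => hsplit.symm.lt_of_mem), hc2, Nat.card_Ico]
    omega
  obtain ⟨p1, hp1⟩ := exists_placement _ hcard1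
  obtain ⟨p2, hp2⟩ := exists_placement _ hcard2
  let e1 : (Fin k1 → ZMod 2) → FSig n m := fun u i => levelSignal d m n K T1 (p1 u) i
  let e2 : (Fin k2 → ZMod 2) → FSig n m := fun v i => levelSignal d m n K T2 (p2 v) i
  obtain ⟨d1, hd1⟩ := exists_decoder (fun u v =>
      (shiftMat (max m n) (max m n - n)).mulVec (e1 u) +
        (shiftMat (max m n) (max m n - m)).mulVec (e2 v))
    (fun u u' v v' heq => hp1 _ _ fun l hl => hsplit.eq_of_relayRx hd hdm heq hl)
  obtain ⟨d2, hd2⟩ := exists_decoder (fun v u =>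
      (shiftMat (max m n) (max m n - m)).mulVec (e1 u) +
        (shiftMat (max m n) (max m n - n)).mulVec (e2 v))
    (fun v v' u u' heq => hp2 _ _ fun l hl => hsplit.symm.eq_of_relayRx hd hdm
      (v := p1 u) (v' := p1 u') (by rw [add_comm]; refine heq.trans (add_comm _ _)) hl)
  exact ⟨e1, e2, d1, d2, hd1, fun u v => hd2 v u⟩

end LevelCode

section Achievability

variable {n m f nb mb : ℕ}

theorem natCeil_two_rpow {N k : ℕ} (hN : 0 < N) :
    ⌈(2 : ℝ) ^ ((N : ℝ) * ((k : ℝ) / N))⌉₊ = 2 ^ k := by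
  have hN' : (N : ℝ) ≠ 0 := by exact_mod_cast hN.ne'
  rw [mul_div_cancel₀ _ hN', Real.rpow_natCast]
  exact_mod_cast Nat.ceil_natCast (R := ℝ) (2 ^ k)

/-- Using the first hop without feedback and forwarding with a delay of one, all but one of the
`N` channel uses are effective. -/
theorem achievable_of_le {k1 k2 : ℕ} (h1 : 2 * n ≤ 3 * m) (h2 : m ≤ 2 * n)
    (hk1 : k1 ≤ (max m n + (n - m) + 1) / 2) (hk2 : k2 ≤ (max m n + (n - m)) / 2)
    (hf1 : k1 ≤ f) (hf2 : k2 ≤ f) (N : ℕ) :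
    Achievable n m f nb mb (((N * k1 : ℕ) : ℝ) / (N + 1 : ℕ)) (((N * k2 : ℕ) : ℝ) / (N + 1 : ℕ)) := by
  obtain ⟨e1, e2, d1, d2, hd1, hd2⟩ := exists_firstHop_code h1 h2 hk1 hk2
  refine ⟨by positivity, by positivity, fun ε hε => ⟨N + 1, N.succ_pos, ?_⟩⟩
  rw [natCeil_two_rpow N.succ_pos, natCeil_two_rpow N.succ_pos]
  have hcard : ∀ k, Fintype.card (Fin N → Fin k → ZMod 2) = 2 ^ (N * k) := by
    intro k
    simp only [Fintype.card_fun, ZMod.card, Fintype.card_fin]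
    rw [← pow_mul, mul_comm]
  let φ1 := (Fintype.equivFinOfCardEq (hcard k1)).symm
  let φ2 := (Fintype.equivFinOfCardEq (hcard k2)).symm
  have hfq : f ≤ max mb (max nb f) := by simp
  let C : Code n m f nb mb (N + 1) (2 ^ (N * k1)) (2 ^ (N * k2)) :=
    { encS1 := fun t w _ => if ht : t < N then e1 (φ1 w ⟨t, ht⟩) else 0
      encS2 := fun t w _ => if ht : t < N then e2 (φ2 w ⟨t, ht⟩) else 0
      encR1 := fun t y i => if h : 0 < t ∧ (i : ℕ) < k1 then
        d1 (y ⟨t - 1, Nat.sub_lt h.1 one_pos⟩) ⟨i, h.2⟩ else 0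
      encR2 := fun t y i => if h : 0 < t ∧ (i : ℕ) < k2 then
        d2 (y ⟨t - 1, Nat.sub_lt h.1 one_pos⟩) ⟨i, h.2⟩ else 0
      dec1 := fun y => φ1.symm fun t i =>
        y t.succ ⟨i + (max mb (max nb f) - f), by have := i.isLt; omega⟩
      dec2 := fun y => φ2.symm fun t i =>
        y t.succ ⟨i + (max mb (max nb f) - f), by have := i.isLt; omega⟩ }
  refine ⟨C, le_trans (le_of_eq ?_) hε.le⟩
  have hX : ∀ w1 w2 (t : Fin N), srcXat C w1 w2 t = (e1 (φ1 w1 t), e2 (φ2 w2 t)) := by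
    intro w1 w2 t
    rw [srcXat_eq]
    simp [C]
  have hdec : ∀ w : Fin (2 ^ (N * k1)) × Fin (2 ^ (N * k2)),
      C.dec1 (fun t => destRx1 C w.1 w.2 t.val) = w.1 ∧
      C.dec2 (fun t => destRx2 C w.1 w.2 t.val) = w.2 := by
    rintro ⟨w1, w2⟩
    constructor
    · refine φ1.symm_apply_eq.2 (funext fun t => funext fun i => ?_)
      have := i.isLt
      simp only [destRx1, relayTxAt1_eq, shiftMat_mulVec]
      simp [C, relayRxAt1_eq, hX, hd1]
    · refine φ2.symm_apply_eq.2 (funext fun t => funext fun i => ?_)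
      have := i.isLt
      simp only [destRx2, relayTxAt2_eq, shiftMat_mulVec]
      simp [C, relayRxAt2_eq, hX, hd2]
  have hempty : (Finset.univ.filter fun w : Fin (2 ^ (N * k1)) × Fin (2 ^ (N * k2)) =>
      C.dec1 (fun t => destRx1 C w.1 w.2 t.val) ≠ w.1 ∨
      C.dec2 (fun t => destRx2 C w.1 w.2 t.val) ≠ w.2) = ∅ :=
    Finset.filter_eq_empty_iff.2 fun w _ hw => hw.elim (· (hdec w).1) (· (hdec w).2)
  rw [errProb, hempty, Finset.card_empty, Nat.cast_zero, zero_div]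

end Achievability

end TwoHopIC

open TwoHopIC in
/-- Sum capacity in the intermediate interference regime; it does not depend on the
overhearing parameters `n̄, m̄`. -/
theorem sumCapacity_intermediate (n m f nb mb : ℕ) (h1 : 2 * n ≤ 3 * m)
    (h2 : m ≤ 2 * n) :
    sumCapacity n m f nb mb = min (max (2 * (n : ℝ) - m) (m : ℝ)) (2 * f) := by
  obtain ⟨s, hs⟩ : ∃ s : ℕ, s = min (max m n + (n - m)) (2 * f) := ⟨_, rfl⟩
  have hB : max (2 * (n : ℝ) - m) (m : ℝ) = ((max m n + (n - m) : ℕ) : ℝ) := by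
    rcases le_total m n with h | h
    · have h' : (m : ℝ) ≤ n := by exact_mod_cast h
      rw [max_eq_left (by linarith), max_eq_right h, Nat.cast_add, Nat.cast_sub h]
      ring
    · have h' : (n : ℝ) ≤ m := by exact_mod_cast h
      rw [max_eq_right (by linarith), max_eq_left h, Nat.sub_eq_zero_of_le h, add_zero]
  have hgoal : min (max (2 * (n : ℝ) - m) (m : ℝ)) (2 * f) = (s : ℝ) := by
    rw [hB, hs]
    push_cast
    rfl
  have hach := fun N => achievable_of_le (nb := nb) (mb := mb) (k1 := (s + 1) / 2) (k2 := s / 2)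
    (f := f) h1 h2 (by omega) (by omega) (by omega) (by omega) N
  rw [hgoal, sumCapacity]
  refine csSup_eq_of_forall_le_of_forall_lt_exists_gt ⟨_, _, _, hach 0, rfl⟩ ?_ ?_
  · rintro r ⟨R1, R2, hR, rfl⟩
    rw [hs, Nat.cast_min]
    exact le_min (hR.add_le _ fun N M1 M2 C => card_decodedPairs_le_firstHop C)
      (hR.add_le _ fun N M1 M2 C => card_decodedPairs_le_secondHop C)
  · intro w hw
    obtain ⟨N, hN⟩ := exists_nat_gt ((s : ℝ) / (s - w))
    refine ⟨_, ⟨_, _, hach N, rfl⟩, ?_⟩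
    have hsplit : N * ((s + 1) / 2) + N * (s / 2) = N * s := by
      rw [← mul_add]
      congr 1
      omega
    rw [← add_div, ← Nat.cast_add, hsplit, lt_div_iff₀ (by positivity)]
    rw [div_lt_iff₀ (by linarith)] at hN
    push_cast
    nlinarith
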